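/- Let G be obtained from the even prism C_n □ K_2 by q TF-inflations (at vertices of at least 3 distinct pillars, c incident to the pillar). If one fixed meandering hamiltonian cycle of the prism enters q₁ of the fragments through the a-vertex (and q − q₁ through the b-vertex), then the total number of hamiltonian cycles of G equals 2^{q₁}·4^{q−q₁} + 4^{q₁}·2^{q−q₁}. -/

import Mathlib

open SimpleGraph

/-- Vertex type of the `n`-prism `C_n □ K_2`: the base cycle consists of the
vertices `(i, false)` (the `sᵢ`) and the top cycle of the vertices `(i, true)` (the `tᵢ`). -/
abbrev PV (n : ℕ) := ZMod n × Bool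

/-- The prism graph `C_n □ K_2`. -/
def prismG (n : ℕ) : SimpleGraph (PV n) :=
  SimpleGraph.fromRel fun u v =>
    (u.1 = v.1 ∧ u.2 ≠ v.2) ∨ (u.2 = v.2 ∧ v.1 = u.1 + 1)

/-- The pillar edge `sᵢtᵢ`. -/
def pillar (n : ℕ) (i : ZMod n) : Sym2 (PV n) :=
  s(((i, false) : PV n), ((i, true) : PV n))

/-- The base-cycle edge `sᵢs_{i+1}`. -/
def baseEdge (n : ℕ) (i : ZMod n) : Sym2 (PV n) :=
  s(((i, false) : PV n), ((i + 1, false) : PV n))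

/-- The top-cycle edge `tᵢt_{i+1}`. -/
def topEdge (n : ℕ) (i : ZMod n) : Sym2 (PV n) :=
  s(((i, true) : PV n), ((i + 1, true) : PV n))

def IsPillar {n : ℕ} (e : Sym2 (PV n)) : Prop := ∃ i, e = pillar n i
def IsBaseEdge {n : ℕ} (e : Sym2 (PV n)) : Prop := ∃ i, e = baseEdge n i
def IsTopEdge {n : ℕ} (e : Sym2 (PV n)) : Prop := ∃ i, e = topEdge n i

/-- A hamiltonian cycle of the prism is *meandering* if no two of its edges lying on the
top cycle or on the base cycle are adjacent (share a vertex; in a cycle, edges sharing a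
vertex are exactly the consecutive ones). -/
def Meandering {n : ℕ} {v : PV n} (C : (prismG n).Walk v v) : Prop :=
  ∀ e ∈ C.edges, ∀ f ∈ C.edges, e ≠ f →
    ((IsBaseEdge e ∧ IsBaseEdge f) ∨ (IsTopEdge e ∧ IsTopEdge f)) → ¬ ∃ x, x ∈ e ∧ x ∈ f

/-- Explicit edge list of the Tutte Fragment on 15 vertices, following Tutte (1946):
`0 = a`, `1 = b` (the two bottom corner 2-valent vertices), `2 = c` (the apex 2-valent
vertex); `3, …, 14` are the internal 3-valent vertices `p₁, …, p₁₂`. -/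
def TFedges : List (Fin 15 × Fin 15) :=
  [(0,4),(4,5),(5,6),(6,2),(1,7),(7,8),(8,2),(0,14),(14,1),(4,9),(9,3),(3,10),(10,7),
   (5,11),(11,12),(6,13),(13,8),(13,12),(12,10),(11,9),(3,14)]

/-- The Tutte Fragment as a simple graph on `Fin 15`. -/
def TF : SimpleGraph (Fin 15) :=
  SimpleGraph.fromRel fun x y => (x, y) ∈ TFedges

/-- The attachment port of the prism vertex `u` used for the former prism edge towards the
neighbour `w`, after the TF-inflations prescribed by the set `S` of inflated vertices and the
orientation choice `orient`.  A non-inflated vertex keeps its single representative (port `0`);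
for an inflated vertex the vertex `c = 2` of its Tutte Fragment is incident with the pillar,
and the vertices `a = 0`, `b = 1` are attached to the two cycle neighbours according to
`orient u`. -/
def port {n : ℕ} (S : Finset (PV n)) (orient : PV n → Bool) (u w : PV n) : Fin 15 :=
  if u ∉ S then 0
  else if u.1 = w.1 then 2
  else if w.1 = u.1 + 1 then (if orient u then 0 else 1)
  else (if orient u then 1 else 0)

/-- Vertex type of the TF-inflated prism: an inflated prism vertex `v ∈ S` is replaced by the
15 vertices `(v, k)` of a fresh copy of the Tutte Fragment, while a non-inflated vertex `v`
is represented by `(v, 0)` alone. -/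
def InflV (n : ℕ) (S : Finset (PV n)) := {x : PV n × Fin 15 // x.1 ∈ S ∨ x.2 = 0}

/-- The graph obtained from the prism `C_n □ K_2` by TF-inflating every vertex in `S`
(with orientations `orient`, and with the `c`-vertex of each fragment incident to the
corresponding pillar). -/
def inflPrism (n : ℕ) (S : Finset (PV n)) (orient : PV n → Bool) :
    SimpleGraph (InflV n S) :=
  SimpleGraph.fromRel fun x y =>
    (x.val.1 = y.val.1 ∧ x.val.1 ∈ S ∧ TF.Adj x.val.2 y.val.2) ∨
    (x.val.1 ≠ y.val.1 ∧ (prismG n).Adj x.val.1 y.val.1 ∧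
      x.val.2 = port S orient x.val.1 y.val.1 ∧
      y.val.2 = port S orient y.val.1 x.val.1)

/-- The vertex of the inflated prism representing the attachment port of the prism vertex `u`
towards its prism neighbour `w`. -/
def liftV {n : ℕ} (S : Finset (PV n)) (orient : PV n → Bool) (u w : PV n) :
    InflV n S :=
  ⟨(u, port S orient u w), by
    by_cases h : u ∈ S
    · exact Or.inl h
    · exact Or.inr (by simp [port, h])⟩

/-- The set of (indices of) pillars of the prism carrying at least one TF-inflated vertex. -/
def inflatedPillars {n : ℕ} (S : Finset (PV n)) : Set (ZMod n) :=
  {i : ZMod n | ((i, false) : PV n) ∈ S ∨ ((i, true) : PV n) ∈ S}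

instance (n : ℕ) (S : Finset (PV n)) : DecidableEq (InflV n S) := by
  unfold InflV; infer_instance

def Ham {V : Type*} (K : SimpleGraph V) : Prop :=
  (∀ v, (K.neighborSet v).ncard = 2) ∧ K.Connected

lemma ham_of_cycle {V : Type*} [DecidableEq V] {G : SimpleGraph V} {x : V} (C : G.Walk x x)
    (hC : C.IsHamiltonianCycle) :
    C.toSubgraph.spanningCoe ≤ G ∧ Ham C.toSubgraph.spanningCoe ∧
      C.toSubgraph.spanningCoe.edgeSet = {e | e ∈ C.edges} := by
  refine ⟨C.toSubgraph.spanningCoe_le, ⟨fun v => ?_, ?_⟩, ?_⟩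
  · exact hC.isCycle.ncard_neighborSet_toSubgraph_eq_two (hC.mem_support v)
  · have hc := C.toSubgraph_connected
    have hs : C.toSubgraph.IsSpanning := by
      intro v; rw [Walk.mem_verts_toSubgraph]; exact hC.mem_support v
    have := (C.toSubgraph.spanningCoeEquivCoeOfSpanning hs).connected_iff
    rw [this]; exact hc.coe
  · ext e
    simp

lemma cycle_of_ham {V : Type*} [DecidableEq V] [Finite V] {G K : SimpleGraph V} (hK : K ≤ G)
    (h : Ham K) : ∃ (x : V) (C : G.Walk x x), C.IsHamiltonianCycle ∧
      K.edgeSet = {e | e ∈ C.edges} := by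
  classical
  obtain ⟨hd, hc⟩ := h
  have := Fintype.ofFinite V
  obtain ⟨x⟩ := hc.nonempty
  have hcy : K.IsCycles := fun v _ => hd v
  have hne : (K.neighborSet x).Nonempty := Set.nonempty_of_ncard_ne_zero (by rw [hd]; decide)
  obtain ⟨p, hp, hv⟩ := hcy.exists_cycle_toSubgraph_verts_eq_connectedComponentSupp
    (c := K.connectedComponentMk x) (v := x) rfl hne
  have hall : ∀ w, w ∈ p.support := by
    intro w
    rw [← Walk.mem_verts_toSubgraph, hv]
    simp only [ConnectedComponent.mem_supp_iff, ConnectedComponent.eq]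
    exact hc.preconnected w x
  have hpH : p.IsHamiltonianCycle := by
    rw [Walk.isHamiltonianCycle_isCycle_and_isHamiltonian_tail]
    refine ⟨hp, ?_⟩
    apply Walk.IsPath.isHamiltonian_of_mem
    · exact hp.isPath_tail
    · intro w
      rw [Walk.support_tail_of_not_nil _ hp.not_nil]
      by_cases hw : w = x
      · subst hw; exact Walk.end_mem_tail_support hp.not_nil
      · have := hall w
        rw [Walk.mem_support_iff] at this
        exact this.resolve_left hw
  refine ⟨x, p.map (Hom.ofLE hK), hpH.map (f := Hom.ofLE hK) Function.bijective_id, ?_⟩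
  ext e
  simp only [Walk.edges_map, Set.mem_ofPred_eq]
  have : (Sym2.map (Hom.ofLE hK)) = id := by
    ext e; induction e; rfl
  rw [this, List.map_id, ← Walk.mem_edges_toSubgraph]
  induction e with
  | _ a b =>
    simp only [mem_edgeSet, Subgraph.mem_edgeSet]
    exact (hp.adj_toSubgraph_iff_of_isCycles hcy
      ((Walk.mem_verts_toSubgraph _).2 (hall a)) b).symm

lemma ham_ncard {V : Type*} [DecidableEq V] [Finite V] (G : SimpleGraph V) :
    {E : Set (Sym2 V) | ∃ (x : V) (C : G.Walk x x),
      C.IsHamiltonianCycle ∧ E = {e | e ∈ C.edges}}.ncard = {K | K ≤ G ∧ Ham K}.ncard := by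
  rw [← Set.ncard_image_of_injective {K | K ≤ G ∧ Ham K} (f := SimpleGraph.edgeSet)
    SimpleGraph.edgeSet_injective]
  congr 1
  ext E
  constructor
  · rintro ⟨x, C, hC, rfl⟩
    obtain ⟨h1, h2, h3⟩ := ham_of_cycle C hC
    exact ⟨_, ⟨h1, h2⟩, h3⟩
  · rintro ⟨K, ⟨h1, h2⟩, rfl⟩
    exact cycle_of_ham h1 h2

/-- cut lemma -/
lemma Ham.cut {V : Type*} {K : SimpleGraph V} (h : Ham K) (W : Set V) (x : V) (hx : x ∈ W)
    (hW : ∀ a ∈ W, ∀ b, K.Adj a b → b ∈ W) (y : V) : y ∈ W := by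
  obtain ⟨p⟩ := h.2.preconnected x y
  induction p with
  | nil => exact hx
  | cons hab p ih => exact ih (hW _ hx _ hab)

def pgR (l : List (Fin 15)) (x y : Fin 15) : Bool :=
  decide ((x, y) ∈ l.zip l.tail) || decide ((y, x) ∈ l.zip l.tail)

def pg (l : List (Fin 15)) : SimpleGraph (Fin 15) where
  Adj x y := x ≠ y ∧ pgR l x y = true
  symm := ⟨fun x y h => ⟨h.1.symm, by have := h.2; simp only [pgR, Bool.or_comm] at this ⊢; exact this⟩⟩
  loopless := ⟨fun _ h => h.1 rfl⟩

instance (l : List (Fin 15)) : DecidableRel (pg l).Adj := fun x y => by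
  unfold pg; infer_instance

def Ls : Bool → List (List (Fin 15))
  | true => [[0, 4, 9, 3, 14, 1, 7, 10, 12, 11, 5, 6, 13, 8, 2],
      [0, 4, 9, 11, 5, 6, 13, 12, 10, 3, 14, 1, 7, 8, 2]]
  | false => [[1, 7, 8, 13, 12, 10, 3, 14, 0, 4, 9, 11, 5, 6, 2],
      [1, 7, 10, 12, 11, 9, 3, 14, 0, 4, 5, 6, 13, 8, 2],
      [1, 14, 0, 4, 5, 6, 13, 12, 11, 9, 3, 10, 7, 8, 2],
      [1, 14, 0, 4, 9, 3, 10, 7, 8, 13, 12, 11, 5, 6, 2]]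

def cutWs : List (List (Fin 15)) :=
  [[0, 1, 3, 4, 7, 9, 10, 14],
   [0, 1, 2, 3, 4, 5, 6, 7, 8, 9, 10, 11, 12, 13, 14],
   [2, 3, 4, 5, 6, 7, 8, 9, 10, 11, 12, 13],
   [2, 6, 8, 13],
   [4, 5, 9, 11],
   [2, 4, 5, 6, 8, 9, 11, 12, 13],
   [2, 6, 7, 8, 10, 12, 13],
   [3, 4, 5, 9, 10, 11, 12],
   [1, 3, 7, 8, 10, 12, 13, 14],
   [1, 3, 7, 9, 10, 11, 12, 14],
   [5, 6, 11, 12, 13],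
   [0, 3, 4, 9, 14],
   [0, 3, 4, 5, 6, 9, 10, 11, 12, 13, 14],
   [3, 7, 8, 9, 10, 11, 12, 13]]

def maskOf (f : Fin 15 → Fin 15 → Bool) : List Bool := TFedges.map fun e => f e.1 e.2

def closedW (W : List (Fin 15)) (m : List Bool) : Bool :=
  (TFedges.zip m).all fun e => !e.2 || (W.contains e.1.1 == W.contains e.1.2)

def resOK (a0 a1 a2 : Bool) (m : List Bool) : Bool :=
  (a2 && a0 && !a1 && (Ls true).any fun l => m == maskOf (pgR l)) ||
  (a2 && !a0 && a1 && (Ls false).any fun l => m == maskOf (pgR l)) ||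
  cutWs.any fun W => !(a0 && W.contains 0) && !(a1 && W.contains 1) && !(a2 && W.contains 2) &&
    closedW W m

set_option synthInstance.maxSize 100000 in
set_option synthInstance.maxHeartbeats 4000000 in
set_option maxRecDepth 100000 in
set_option maxHeartbeats 4000000 in
lemma boolLem :
    ∀ a0 a1 a2 : Bool,
    ∀ e0 e7 : Bool,
    (e0.toNat + e7.toNat + a0.toNat = 2) →
    ∀ e8 e20 : Bool,
    (e7.toNat + e8.toNat + e20.toNat = 2) →
    ∀ e4 : Bool,
    (e4.toNat + e8.toNat + a1.toNat = 2) →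
    ∀ e1 e9 : Bool,
    (e0.toNat + e1.toNat + e9.toNat = 2) →
    ∀ e10 e19 : Bool,
    (e10.toNat + e9.toNat + e19.toNat = 2) →
    ∀ e11 : Bool,
    (e10.toNat + e11.toNat + e20.toNat = 2) →
    ∀ e12 e18 : Bool,
    (e11.toNat + e12.toNat + e18.toNat = 2) →
    ∀ e5 : Bool,
    (e4.toNat + e5.toNat + e12.toNat = 2) →
    ∀ e3 e6 : Bool,
    (e3.toNat + e6.toNat + a2.toNat = 2) →
    ∀ e2 e13 : Bool,
    (e1.toNat + e2.toNat + e13.toNat = 2) →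
    ∀ e15 : Bool,
    (e3.toNat + e2.toNat + e15.toNat = 2) →
    ∀ e16 : Bool,
    (e6.toNat + e5.toNat + e16.toNat = 2) →
    ∀ e14 : Bool,
    (e13.toNat + e19.toNat + e14.toNat = 2) →
    ∀ e17 : Bool,
    (e15.toNat + e16.toNat + e17.toNat = 2) →
    (e18.toNat + e14.toNat + e17.toNat = 2) →
    resOK a0 a1 a2 [e0, e1, e2, e3, e4, e5, e6, e7, e8, e9, e10, e11, e12, e13, e14, e15, e16, e17, e18, e19, e20] = true := by
  decide +kernel

def nb (k : Fin 15) : List (Fin 15) :=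
  (List.finRange 15).filter fun l => decide ((k, l) ∈ TFedges ∨ (l, k) ∈ TFedges)

open Classical in
noncomputable def LF (s : Bool) : Finset (SimpleGraph (Fin 15)) := ((Ls s).map pg).toFinset

lemma mem_LF {s : Bool} {X : SimpleGraph (Fin 15)} : X ∈ LF s ↔ ∃ l ∈ Ls s, pg l = X := by
  classical
  simp [LF]

lemma TF_adj (x y : Fin 15) : TF.Adj x y ↔ (x, y) ∈ TFedges ∨ (y, x) ∈ TFedges := by
  simp only [TF, fromRel_adj, and_iff_right_iff_imp]
  revert x y; decide +kernel

set_option synthInstance.maxSize 10000 in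
set_option synthInstance.maxHeartbeats 400000 in
lemma pg_le : ∀ s, ∀ l ∈ Ls s, pg l ≤ TF := by
  have : ∀ s, ∀ l ∈ Ls s, ∀ x y, pgR l x y = true → ((x, y) ∈ TFedges ∨ (y, x) ∈ TFedges) := by
    decide +kernel
  intro s l hl x y h
  exact (TF_adj x y).2 (this s l hl x y h.2)

lemma pg_ne : ∀ e ∈ TFedges, e.1 ≠ e.2 := by decide +kernel

lemma eq_pg {X : SimpleGraph (Fin 15)} (hX : X ≤ TF) (f : Fin 15 → Fin 15 → Bool)
    (hf : ∀ x y, f x y = true ↔ X.Adj x y) {s : Bool} {l : List (Fin 15)} (hl : l ∈ Ls s)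
    (hm : maskOf f = maskOf (pgR l)) : pg l = X := by
  have h : ∀ e ∈ TFedges, f e.1 e.2 = pgR l e.1 e.2 := List.map_inj_left.1 hm
  have h2 : ∀ x y, (x, y) ∈ TFedges → (X.Adj x y ↔ (pg l).Adj x y) := by
    intro x y hxy
    rw [← hf, h _ hxy]
    simp [pg, pg_ne _ hxy]
  ext x y
  constructor
  · intro hp
    rcases (TF_adj x y).1 (pg_le s l hl hp) with h1 | h1
    · exact (h2 _ _ h1).2 hp
    · exact ((h2 _ _ h1).2 hp.symm).symm
  · intro hp
    rcases (TF_adj x y).1 (hX hp) with h1 | h1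
    · exact (h2 _ _ h1).1 hp
    · exact ((h2 _ _ h1).1 hp.symm).symm

lemma closedW_map (W : List (Fin 15)) (f : Fin 15 → Fin 15 → Bool)
    (h : closedW W (maskOf f) = true) :
    ∀ e ∈ TFedges, f e.1 e.2 = true → (e.1 ∈ W ↔ e.2 ∈ W) := by
  intro e he hfe
  simp only [closedW, List.all_eq_true] at h
  have : (e, f e.1 e.2) ∈ TFedges.zip (maskOf f) := by
    unfold maskOf
    generalize TFedges = L at he
    induction L with
    | nil => simp at he
    | cons a L ih =>
      simp only [List.map_cons, List.zip_cons_cons, List.mem_cons] at he ⊢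
      rcases he with rfl | he
      · left; rfl
      · right; exact ih he
  have := h _ this
  simp only [hfe, Bool.not_true, Bool.false_or, beq_iff_eq] at this
  rw [Bool.eq_iff_iff] at this
  simpa using this

lemma cutWs_ne : ∀ W ∈ cutWs, W ≠ [] := by decide

lemma loc (X : SimpleGraph (Fin 15)) (hX : X ≤ TF) (A : Fin 15 → Prop) [DecidablePred A]
    (hA : ∀ k, A k → k = 0 ∨ k = 1 ∨ k = 2)
    (hd : ∀ k, (X.neighborSet k).ncard + (if A k then 1 else 0) = 2)
    (hcut : ∀ W : Set (Fin 15), W.Nonempty → (∀ k ∈ W, ¬ A k) →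
      (∀ k ∈ W, ∀ l, X.Adj k l → l ∈ W) → False) :
    (A 2 ∧ A 0 ∧ ¬ A 1 ∧ X ∈ LF true) ∨ (A 2 ∧ ¬ A 0 ∧ A 1 ∧ X ∈ LF false) := by
  classical
  obtain ⟨f, hf⟩ : ∃ f : Fin 15 → Fin 15 → Bool, ∀ x y, f x y = true ↔ X.Adj x y :=
    ⟨fun x y => decide (X.Adj x y), by simp⟩
  have fs : ∀ x y, f x y = f y x := by
    intro x y; rw [Bool.eq_iff_iff, hf, hf, X.adj_comm]
  have hA3 : ∀ k : Fin 15, 3 ≤ k → ¬ A k := by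
    intro k hk h
    rcases hA k h with rfl | rfl | rfl <;> revert hk <;> decide
  have key : ∀ k, (X.neighborSet k).ncard = ((nb k).map fun l => (f k l).toNat).sum := by
    intro k
    have h1 : X.neighborSet k = ↑((nb k).toFinset.filter fun l => f k l = true) := by
      ext l
      simp only [mem_neighborSet, Finset.coe_filter, List.mem_toFinset, Set.mem_ofPred_eq, hf]
      constructor
      · intro h
        refine ⟨?_, h⟩
        simp only [nb, List.mem_filter, List.mem_finRange, true_and, decide_eq_true_eq]
        exact (TF_adj _ _).1 (hX h)
      · exact fun h => h.2
    have hn : (nb k).Nodup := List.Nodup.filter _ (List.nodup_finRange 15)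
    rw [h1, Set.ncard_coe_finset, Finset.card_filter, List.sum_toFinset _ hn]
    congr 1
    apply List.map_congr_left
    intro l _
    cases f k l <;> simp
  have hd' : ∀ k, ((nb k).map fun l => (f k l).toNat).sum + (decide (A k)).toNat = 2 := by
    intro k
    rw [← key, ← hd k]
    congr 1
    by_cases h : A k <;> simp [h]
  have h0 : (f 0 4).toNat + (f 0 14).toNat + (decide (A 0)).toNat = 2 := by
    have h := hd' 0
    simp only [show nb 0 = [4, 14] by decide, List.map_cons, List.map_nil,
      List.sum_cons, List.sum_nil] at h
    simpa [add_assoc] using h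
  have h14 : (f 0 14).toNat + (f 14 1).toNat + (f 3 14).toNat = 2 := by
    have h := hd' 14
    simp only [show nb 14 = [0, 1, 3] by decide, List.map_cons, List.map_nil,
      List.sum_cons, List.sum_nil, fs 14 0, fs 14 3] at h
    simpa [add_assoc, hA3 14 (by decide)] using h
  have h1 : (f 1 7).toNat + (f 14 1).toNat + (decide (A 1)).toNat = 2 := by
    have h := hd' 1
    simp only [show nb 1 = [7, 14] by decide, List.map_cons, List.map_nil,
      List.sum_cons, List.sum_nil, fs 1 14] at h
    simpa [add_assoc] using h
  have h4 : (f 0 4).toNat + (f 4 5).toNat + (f 4 9).toNat = 2 := by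
    have h := hd' 4
    simp only [show nb 4 = [0, 5, 9] by decide, List.map_cons, List.map_nil,
      List.sum_cons, List.sum_nil, fs 4 0] at h
    simpa [add_assoc, hA3 4 (by decide)] using h
  have h9 : (f 9 3).toNat + (f 4 9).toNat + (f 11 9).toNat = 2 := by
    have h := hd' 9
    simp only [show nb 9 = [3, 4, 11] by decide, List.map_cons, List.map_nil,
      List.sum_cons, List.sum_nil, fs 9 4, fs 9 11] at h
    simpa [add_assoc, hA3 9 (by decide)] using h
  have h3 : (f 9 3).toNat + (f 3 10).toNat + (f 3 14).toNat = 2 := by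
    have h := hd' 3
    simp only [show nb 3 = [9, 10, 14] by decide, List.map_cons, List.map_nil,
      List.sum_cons, List.sum_nil, fs 3 9] at h
    simpa [add_assoc, hA3 3 (by decide)] using h
  have h10 : (f 3 10).toNat + (f 10 7).toNat + (f 12 10).toNat = 2 := by
    have h := hd' 10
    simp only [show nb 10 = [3, 7, 12] by decide, List.map_cons, List.map_nil,
      List.sum_cons, List.sum_nil, fs 10 3, fs 10 12] at h
    simpa [add_assoc, hA3 10 (by decide)] using h
  have h7 : (f 1 7).toNat + (f 7 8).toNat + (f 10 7).toNat = 2 := by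
    have h := hd' 7
    simp only [show nb 7 = [1, 8, 10] by decide, List.map_cons, List.map_nil,
      List.sum_cons, List.sum_nil, fs 7 1, fs 7 10] at h
    simpa [add_assoc, hA3 7 (by decide)] using h
  have h2 : (f 6 2).toNat + (f 8 2).toNat + (decide (A 2)).toNat = 2 := by
    have h := hd' 2
    simp only [show nb 2 = [6, 8] by decide, List.map_cons, List.map_nil,
      List.sum_cons, List.sum_nil, fs 2 6, fs 2 8] at h
    simpa [add_assoc] using h
  have h5 : (f 4 5).toNat + (f 5 6).toNat + (f 5 11).toNat = 2 := by
    have h := hd' 5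
    simp only [show nb 5 = [4, 6, 11] by decide, List.map_cons, List.map_nil,
      List.sum_cons, List.sum_nil, fs 5 4] at h
    simpa [add_assoc, hA3 5 (by decide)] using h
  have h6 : (f 6 2).toNat + (f 5 6).toNat + (f 6 13).toNat = 2 := by
    have h := hd' 6
    simp only [show nb 6 = [2, 5, 13] by decide, List.map_cons, List.map_nil,
      List.sum_cons, List.sum_nil, fs 6 5] at h
    simpa [add_assoc, hA3 6 (by decide)] using h
  have h8 : (f 8 2).toNat + (f 7 8).toNat + (f 13 8).toNat = 2 := by
    have h := hd' 8
    simp only [show nb 8 = [2, 7, 13] by decide, List.map_cons, List.map_nil,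
      List.sum_cons, List.sum_nil, fs 8 7, fs 8 13] at h
    simpa [add_assoc, hA3 8 (by decide)] using h
  have h11 : (f 5 11).toNat + (f 11 9).toNat + (f 11 12).toNat = 2 := by
    have h := hd' 11
    simp only [show nb 11 = [5, 9, 12] by decide, List.map_cons, List.map_nil,
      List.sum_cons, List.sum_nil, fs 11 5] at h
    simpa [add_assoc, hA3 11 (by decide)] using h
  have h13 : (f 6 13).toNat + (f 13 8).toNat + (f 13 12).toNat = 2 := by
    have h := hd' 13
    simp only [show nb 13 = [6, 8, 12] by decide, List.map_cons, List.map_nil,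
      List.sum_cons, List.sum_nil, fs 13 6] at h
    simpa [add_assoc, hA3 13 (by decide)] using h
  have h12 : (f 12 10).toNat + (f 11 12).toNat + (f 13 12).toNat = 2 := by
    have h := hd' 12
    simp only [show nb 12 = [10, 11, 13] by decide, List.map_cons, List.map_nil,
      List.sum_cons, List.sum_nil, fs 12 11, fs 12 13] at h
    simpa [add_assoc, hA3 12 (by decide)] using h
  have hres := boolLem _ _ _ _ _ h0 _ _ h14 _ h1 _ _ h4 _ _ h9 _ h3 _ _ h10 _ h7 _ _ h2 _ _ h5 _ h6 _ h8 _ h11 _ h13 h12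
  change resOK _ _ _ (maskOf f) = true at hres
  simp only [resOK, Bool.or_eq_true, Bool.and_eq_true, decide_eq_true_eq, List.any_eq_true,
    Bool.not_eq_true', decide_eq_false_iff_not, beq_iff_eq] at hres
  rcases hres with (⟨⟨⟨q2, q0⟩, q1⟩, l, hl, hm⟩ | ⟨⟨⟨q2, q0⟩, q1⟩, l, hl, hm⟩) | ⟨W, hW, hw, hc⟩
  · exact Or.inl ⟨q2, q0, q1, mem_LF.2 ⟨l, hl, eq_pg hX f hf hl hm⟩⟩
  · exact Or.inr ⟨q2, q0, q1, mem_LF.2 ⟨l, hl, eq_pg hX f hf hl hm⟩⟩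
  · exfalso
    have hcl := closedW_map W f hc
    apply hcut {k | k ∈ W}
    · obtain ⟨a, ha⟩ := List.exists_mem_of_ne_nil W (cutWs_ne W hW)
      exact ⟨a, ha⟩
    · intro k hk hAk
      have hk : k ∈ W := hk
      rcases hA k hAk with rfl | rfl | rfl <;> simp [hk, hAk] at hw
    · intro k hk l hkl
      rcases (TF_adj k l).1 (hX hkl) with h1 | h1
      · exact (hcl _ h1 ((hf _ _).2 hkl)).1 hk
      · exact (hcl _ h1 ((hf _ _).2 hkl.symm)).2 hk

lemma LF_le {s : Bool} {X : SimpleGraph (Fin 15)} (h : X ∈ LF s) : X ≤ TF := by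
  obtain ⟨l, hl, rfl⟩ := mem_LF.1 h
  exact pg_le s l hl

lemma LF_deg {s : Bool} {X : SimpleGraph (Fin 15)} (h : X ∈ LF s) (k : Fin 15) :
    (X.neighborSet k).ncard + (if k = 2 ∨ k = (if s then 0 else 1) then 1 else 0) = 2 := by
  obtain ⟨l, hl, rfl⟩ := mem_LF.1 h
  have : ∀ s, ∀ l ∈ Ls s, ∀ k : Fin 15, (Finset.univ.filter fun j => (pg l).Adj k j).card +
    (if k = 2 ∨ k = (if s = true then 0 else 1) then 1 else 0) = 2 := by decide +kernel
  rw [← this s l hl k, ← Set.ncard_coe_finset]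
  congr 2
  ext; simp

lemma LF_conn {s : Bool} {X : SimpleGraph (Fin 15)} (h : X ∈ LF s) : X.Connected := by
  obtain ⟨l, hl, rfl⟩ := mem_LF.1 h
  have h1 : ∀ s, ∀ l ∈ Ls s, (∀ i : Fin 14, (pg l).Adj (l.getD i 0) (l.getD (i + 1) 0)) ∧
      (∀ x : Fin 15, ∃ i : Fin 15, l.getD i 0 = x) := by decide +kernel
  obtain ⟨h2, h3⟩ := h1 s l hl
  have h4 : ∀ i : ℕ, i < 15 → (pg l).Reachable (l.getD 0 0) (l.getD i 0) := by
    intro i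
    induction i with
    | zero => intro _; exact Reachable.refl _
    | succ i ih => 
      intro hi
      exact (ih (by omega)).trans (h2 ⟨i, by omega⟩).reachable
  have h5 : ∀ x, (pg l).Reachable (l.getD 0 0) x := by
    intro x
    obtain ⟨i, rfl⟩ := h3 x
    exact h4 i i.2
  exact ⟨fun x y => (h5 x).symm.trans (h5 y)⟩

lemma LF_card (s : Bool) : (LF s).card = if s then 2 else 4 := by
  classical
  have h1 : ∀ s, ∀ l ∈ Ls s, ∀ l' ∈ Ls s, (∀ x y, (pg l).Adj x y ↔ (pg l').Adj x y) → l = l' := by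
    decide +kernel
  have h2 : ∀ s, (Ls s).Nodup := by decide
  have h3 : ((Ls s).map pg).Nodup := by
    apply List.Nodup.map_on _ (h2 s)
    intro l hl l' hl' h
    exact h1 s l hl l' hl' (fun x y => by rw [h])
  rw [LF, List.toFinset_card_of_nodup h3, List.length_map]
  cases s <;> rfl

def pil {n : ℕ} (u : PV n) : PV n := (u.1, !u.2)
def nx {n : ℕ} (u : PV n) : PV n := (u.1 + 1, u.2)
def pv {n : ℕ} (u : PV n) : PV n := (u.1 - 1, u.2)

section
variable {n : ℕ}

@[simp] lemma pil_pil (u : PV n) : pil (pil u) = u := by simp [pil]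
@[simp] lemma nx_pv (u : PV n) : nx (pv u) = u := by simp [nx, pv]
@[simp] lemma pv_nx (u : PV n) : pv (nx u) = u := by simp [nx, pv]
lemma pil_nx (u : PV n) : pil (nx u) = nx (pil u) := by simp [nx, pil]
lemma pil_pv (u : PV n) : pil (pv u) = pv (pil u) := by simp [pv, pil]

lemma one_ne (hn : 3 ≤ n) : (1 : ZMod n) ≠ 0 := by
  have : ((1 : ℕ) : ZMod n) ≠ 0 := by
    rw [Ne, ZMod.natCast_eq_zero_iff]
    intro h; have := Nat.le_of_dvd (by omega) h; omega
  simpa using this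

lemma two_ne (hn : 3 ≤ n) : (1 : ZMod n) + 1 ≠ 0 := by
  have : ((2 : ℕ) : ZMod n) ≠ 0 := by
    rw [Ne, ZMod.natCast_eq_zero_iff]
    intro h; have := Nat.le_of_dvd (by omega) h; omega
  intro h; apply this; push_cast; rw [← h]; norm_num

lemma pil_ne_nx (u : PV n) : pil u ≠ nx u := by
  intro h; have := congrArg Prod.snd h; simp [pil, nx] at this
lemma pil_ne_pv (u : PV n) : pil u ≠ pv u := by
  intro h; have := congrArg Prod.snd h; simp [pil, pv] at this
lemma nx_ne_pv (hn : 3 ≤ n) (u : PV n) : nx u ≠ pv u := by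
  intro h; have := congrArg Prod.fst h; simp only [nx, pv] at this
  apply two_ne hn; linear_combination this

lemma prism_adj (hn : 3 ≤ n) (u w : PV n) :
    (prismG n).Adj u w ↔ w = pil u ∨ w = nx u ∨ w = pv u := by
  obtain ⟨i, c⟩ := u
  obtain ⟨j, d⟩ := w
  have h1 := one_ne hn
  have e1 : i = j + 1 ↔ j = i - 1 := ⟨fun h => by rw [h]; ring, fun h => by rw [h]; ring⟩
  simp only [prismG, fromRel_adj, pil, nx, pv, Prod.mk.injEq, ne_eq, e1]
  have e2 : c ≠ d ↔ d = !c := by cases c <;> cases d <;> simp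
  have e3 : d ≠ c ↔ d = !c := by cases c <;> cases d <;> simp
  constructor
  · rintro ⟨h, (⟨rfl, h2⟩ | ⟨rfl, rfl⟩) | (⟨rfl, h2⟩ | ⟨rfl, rfl⟩)⟩
    · left; exact ⟨rfl, e2.1 h2⟩
    · simp
    · left; exact ⟨rfl, e3.1 h2⟩
    · simp
  · rintro (⟨rfl, rfl⟩ | ⟨rfl, rfl⟩ | ⟨rfl, rfl⟩)
    · simp
    · simp [h1]
    · refine ⟨?_, by simp⟩
      rintro ⟨h, -⟩
      apply h1
      linear_combination h

def Ex2 (x y z : Prop) : Prop := (x ∧ y ∧ ¬ z) ∨ (x ∧ ¬ y ∧ z) ∨ (¬ x ∧ y ∧ z)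

lemma nbr_iff (hn : 3 ≤ n) {P : SimpleGraph (PV n)} (hP : P ≤ prismG n) (u : PV n) :
    (P.neighborSet u).ncard = 2 ↔ Ex2 (P.Adj u (pil u)) (P.Adj u (nx u)) (P.Adj u (pv u)) := by
  classical
  have h1 : P.neighborSet u = ↑(({pil u, nx u, pv u} : Finset (PV n)).filter fun w => P.Adj u w) := by
    ext w
    simp only [mem_neighborSet, Finset.coe_filter, Set.mem_ofPred_eq, Finset.mem_insert,
      Finset.mem_singleton]
    exact ⟨fun h => ⟨(prism_adj hn u w).1 (hP h), h⟩, fun h => h.2⟩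
  rw [h1, Set.ncard_coe_finset, Finset.card_filter,
    Finset.sum_insert (by simp [pil_ne_nx, pil_ne_pv]),
    Finset.sum_insert (by simp [nx_ne_pv hn]), Finset.sum_singleton]
  unfold Ex2
  by_cases a : P.Adj u (pil u) <;> by_cases b : P.Adj u (nx u) <;> by_cases c : P.Adj u (pv u) <;>
    simp [a, b, c]

lemma zmod_ind [NeZero n] {Q : ZMod n → Prop} (i : ZMod n) (h0 : Q i)
    (hs : ∀ j, Q j → Q (j + 1)) (j : ZMod n) : Q j := by
  have : ∀ m : ℕ, Q (i + m) := by
    intro m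
    induction m with
    | zero => simpa using h0
    | succ m ih =>
      have := hs _ ih
      rw [add_assoc] at this
      simpa using this
  have h := this (j - i).val
  rw [ZMod.natCast_zmod_val] at h
  simpa using h

/-- the class property -/
def Cls (P : SimpleGraph (PV n)) : Prop :=
  ∀ u, P.Adj u (pil u) ∧ (P.Adj u (pv u) ↔ ¬ P.Adj u (nx u)) ∧
    (P.Adj u (nx u) ↔ ¬ P.Adj (pil u) (nx (pil u)))

lemma cls_of_ham (hn : 3 ≤ n) {P : SimpleGraph (PV n)} (hP : P ≤ prismG n) (hH : Ham P)
    (h3 : 3 ≤ {i : ZMod n | P.Adj (i, false) (i, true)}.ncard) : Cls P := by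
  have : NeZero n := ⟨by omega⟩
  have hd := fun u => (nbr_iff hn hP u).1 (hH.1 u)
  have hpv : ∀ u, P.Adj u (pv u) ↔ P.Adj (pv u) (nx (pv u)) := by
    intro u; rw [nx_pv, P.adj_comm]
  have hpp : ∀ u, P.Adj (pil u) u ↔ P.Adj u (pil u) := fun u => P.adj_comm _ _
  by_cases hc : ∃ i, ¬ (P.Adj (i, false) (nx (i, false)) ↔ P.Adj (i, true) (nx (i, true)))
  · obtain ⟨i, hi⟩ := hc
    have hall : ∀ j, ¬ (P.Adj (j, false) (nx (j, false)) ↔ P.Adj (j, true) (nx (j, true))) := by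
      refine fun j => zmod_ind (Q := fun j => ¬ (P.Adj (j, false) (nx (j, false)) ↔
        P.Adj (j, true) (nx (j, true)))) i hi (fun j hj => ?_) j
      have d1 := hd (nx (j, false))
      have d2 := hd (nx (j, true))
      rw [hpv, pv_nx] at d1 d2
      have e : P.Adj (nx (j, false)) (pil (nx (j, false))) ↔
        P.Adj (nx (j, true)) (pil (nx (j, true))) := P.adj_comm _ _
      change ¬ (P.Adj (nx (j, false)) (nx (nx (j, false))) ↔
        P.Adj (nx (j, true)) (nx (nx (j, true))))
      unfold Ex2 at d1 d2
      tauto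
    have hall' : ∀ u, ¬ (P.Adj u (nx u) ↔ P.Adj (pil u) (nx (pil u))) := by
      rintro ⟨j, c⟩
      have := hall j
      cases c
      · exact this
      · intro h; exact this h.symm
    intro u
    have d1 := hd u
    have d2 := hd (pil u)
    have a1 := hall' u
    have a2 := hall' (pv u)
    rw [hpv] at d1 d2
    rw [pil_pil, hpp, ← pil_pv] at d2
    rw [hpv]
    unfold Ex2 at d1 d2
    tauto
  · push Not at hc
    exfalso
    by_cases hg : ∃ g g', g ≠ g' ∧ ¬ P.Adj (g, false) (nx (g, false)) ∧
        ¬ P.Adj (g', false) (nx (g', false))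
    · obtain ⟨g, g', hne, h1, h2⟩ := hg
      have h1' : ∀ c, ¬ P.Adj (g, c) (nx (g, c)) := by
        intro c; cases c; exacts [h1, fun h => h1 ((hc g).2 h)]
      have h2' : ∀ c, ¬ P.Adj (g', c) (nx (g', c)) := by
        intro c; cases c; exacts [h2, fun h => h2 ((hc g').2 h)]
      set M := (g' - (g + 1)).val with hM
      have hMn : M < n - 1 := by
        have := ZMod.val_lt (g' - (g + 1))
        by_contra hlt
        have hMe : M = n - 1 := by omega
        apply hne
        have e1 : ((M : ℕ) : ZMod n) = g' - (g + 1) := by rw [hM, ZMod.natCast_zmod_val]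
        have e2 : ((M + 1 : ℕ) : ZMod n) = 0 := by
          rw [hMe, Nat.sub_add_cancel (by omega)]; simp
        push_cast at e2
        linear_combination e1 - e2
      have hcl := hH.cut {u | (u.1 - (g + 1)).val ≤ M} (g', false) (show _ ≤ M from le_refl _) ?_ (g, false)
      · have hcl : (g - (g + 1)).val ≤ M := hcl
        have e : g - (g + 1) = ((n - 1 : ℕ) : ZMod n) := by
          rw [Nat.cast_sub (by omega)]; simp
        rw [e, ZMod.val_natCast_of_lt (by omega)] at hcl
        omega
      · rintro ⟨a, c⟩ ha w haw
        have ha : (a - (g + 1)).val ≤ M := ha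
        change (w.1 - (g + 1)).val ≤ M
        obtain ⟨m, hm⟩ : ∃ m, m = (a - (g + 1)).val := ⟨_, rfl⟩
        have hma : ((m : ℕ) : ZMod n) = a - (g + 1) := by rw [hm, ZMod.natCast_zmod_val]
        rcases (prism_adj hn _ _).1 (hP haw) with rfl | rfl | rfl
        · exact ha
        · have hag : a ≠ g' := by rintro rfl; exact h2' c haw
          have hmM : m ≠ M := by
            intro h
            apply hag
            have e1 : ((M : ℕ) : ZMod n) = g' - (g + 1) := by rw [hM, ZMod.natCast_zmod_val]
            rw [h] at hma
            linear_combination e1 - hma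
          have e : (nx (a, c)).1 - (g + 1) = ((m + 1 : ℕ) : ZMod n) := by
            push_cast; rw [hma]; simp only [nx]; ring
          rw [e, ZMod.val_natCast_of_lt (by omega)]
          omega
        · have hm0 : m ≠ 0 := by
            rintro rfl
            have : a = g + 1 := by
              simp only [Nat.cast_zero] at hma
              linear_combination -hma
            subst this
            apply h1' c
            have e : pv (g + 1, c) = (g, c) := by simp [pv]
            rw [e] at haw
            exact haw.symm
          have e : (pv (a, c)).1 - (g + 1) = ((m - 1 : ℕ) : ZMod n) := by
            rw [Nat.cast_sub (by omega), hma]; simp only [pv]; push_cast; ring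
          rw [e, ZMod.val_natCast_of_lt (by omega)]
          omega
    · push Not at hg
      have hsub : ∃ g, {i : ZMod n | P.Adj (i, false) (i, true)} ⊆ {g, g + 1} := by
        have hpg : ∀ i, P.Adj (i, false) (i, true) → ¬ P.Adj (i, false) (nx (i, false)) ∨
            ¬ P.Adj (i - 1, false) (nx (i - 1, false)) := by
          intro i hi
          have d := hd (i, false)
          rw [hpv] at d
          change Ex2 (P.Adj (i, false) (i, true)) _ (P.Adj (i - 1, false) (nx (i - 1, false))) at d
          unfold Ex2 at d
          tauto
        by_cases hex : ∃ g, ¬ P.Adj (g, false) (nx (g, false))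
        · obtain ⟨g, hgg⟩ := hex
          refine ⟨g, fun i hi => ?_⟩
          rcases hpg i hi with h | h
          · left
            by_contra hne
            exact h (hg g i (Ne.symm hne) hgg)
          · right
            by_contra hne
            refine h (hg g (i - 1) ?_ hgg)
            rintro rfl
            apply hne
            simp
        · push Not at hex
          refine ⟨0, fun i hi => ?_⟩
          exfalso
          rcases hpg i hi with h | h
          · exact h (hex _)
          · exact h (hex _)
      obtain ⟨g, hsub⟩ := hsub
      have h4 := Set.ncard_le_ncard hsub
      have h5 := Set.ncard_insert_le g {g + 1}
      rw [Set.ncard_singleton] at h5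
      omega

def swP (P : SimpleGraph (PV n)) : SimpleGraph (PV n) := P.comap pil

lemma swP_adj (P : SimpleGraph (PV n)) (u w) : (swP P).Adj u w ↔ P.Adj (pil u) (pil w) := Iff.rfl

lemma swP_le (hn : 3 ≤ n) {P : SimpleGraph (PV n)} (hP : P ≤ prismG n) : swP P ≤ prismG n := by
  intro u w h
  have := (prism_adj hn _ _).1 (hP h)
  rw [← pil_nx, ← pil_pv] at this
  have hi : Function.Injective (pil : PV n → PV n) :=
    Function.LeftInverse.injective (g := pil) pil_pil
  rw [hi.eq_iff, hi.eq_iff, hi.eq_iff] at this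
  exact (prism_adj hn _ _).2 this

lemma ham_iso {V W : Type*} {G : SimpleGraph V} {G' : SimpleGraph W} (e : G ≃g G') (h : Ham G') :
    Ham G := by
  refine ⟨fun v => ?_, e.connected_iff.2 h.2⟩
  rw [← h.1 (e v), ← Set.ncard_image_of_injective _ e.injective]
  congr 1
  ext w
  constructor
  · rintro ⟨x, hx, rfl⟩
    exact e.map_adj_iff.2 hx
  · intro hw
    refine ⟨e.symm w, ?_, by simp⟩
    rw [mem_neighborSet, ← e.map_adj_iff]
    simpa using hw

lemma swP_ham {P : SimpleGraph (PV n)} (h : Ham P) : Ham (swP P) :=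
  ham_iso (G' := P) ⟨⟨pil, pil, pil_pil, pil_pil⟩, Iff.rfl⟩ h

lemma swP_nx {P : SimpleGraph (PV n)} (h : Cls P) (u : PV n) :
    (swP P).Adj u (nx u) ↔ ¬ P.Adj u (nx u) := by
  rw [swP_adj, pil_nx]
  have := (h u).2.2
  tauto

lemma eq_of_nx (hn : 3 ≤ n) {P Q : SimpleGraph (PV n)} (hP : P ≤ prismG n) (hQ : Q ≤ prismG n)
    (h1 : ∀ u, P.Adj u (pil u)) (h2 : ∀ u, Q.Adj u (pil u))
    (h : ∀ u, P.Adj u (nx u) ↔ Q.Adj u (nx u)) : P = Q := by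
  have key : ∀ u w, (prismG n).Adj u w → (P.Adj u w ↔ Q.Adj u w) := by
    intro u w hu
    rcases (prism_adj hn _ _).1 hu with rfl | rfl | rfl
    · simp [h1, h2]
    · exact h u
    · have := h (pv u)
      rw [nx_pv] at this
      rw [P.adj_comm, Q.adj_comm, this]
  ext u w
  exact ⟨fun hh => (key u w (hP hh)).1 hh, fun hh => (key u w (hQ hh)).2 hh⟩

lemma cls_swP {P : SimpleGraph (PV n)} (h : Cls P) : Cls (swP P) := by
  intro u
  simp only [swP_adj]
  have := h (pil u)
  rw [pil_nx, pil_pv]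
  simpa only [pil_nx, pil_pil] using this

lemma cls_two (hn : 3 ≤ n) {P Q : SimpleGraph (PV n)} (hP : P ≤ prismG n) (hQ : Q ≤ prismG n)
    (h1 : Cls P) (h2 : Cls Q) : P = Q ∨ P = swP Q := by
  have : NeZero n := ⟨by omega⟩
  have alt : ∀ {P : SimpleGraph (PV n)}, Cls P → ∀ u, P.Adj (nx u) (nx (nx u)) ↔ ¬ P.Adj u (nx u) := by
    intro P h u
    have := (h (nx u)).2.1
    rw [pv_nx, P.adj_comm] at this
    tauto
  have tr : ∀ {P Q : SimpleGraph (PV n)}, Cls P → Cls Q →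
      (P.Adj (0, false) (nx (0, false)) ↔ Q.Adj (0, false) (nx (0, false))) →
      ∀ u, P.Adj u (nx u) ↔ Q.Adj u (nx u) := by
    intro P Q h1 h2 h0
    have hf : ∀ i : ZMod n, P.Adj (i, false) (nx (i, false)) ↔ Q.Adj (i, false) (nx (i, false)) := by
      refine fun j => zmod_ind (Q := fun i => P.Adj (i, false) (nx (i, false)) ↔
        Q.Adj (i, false) (nx (i, false))) 0 h0 (fun j hj => ?_) j
      have := alt h1 (j, false)
      have := alt h2 (j, false)
      change P.Adj (nx (j, false)) (nx (nx (j, false))) ↔ Q.Adj (nx (j, false)) (nx (nx (j, false)))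
      tauto
    rintro ⟨i, c⟩
    cases c
    · exact hf i
    · have a := (h1 (i, true)).2.2
      have b := (h2 (i, true)).2.2
      have := hf i
      change _ ↔ ¬ P.Adj (i, false) (nx (i, false)) at a
      change _ ↔ ¬ Q.Adj (i, false) (nx (i, false)) at b
      tauto
  by_cases h0 : P.Adj (0, false) (nx (0, false)) ↔ Q.Adj (0, false) (nx (0, false))
  · left
    exact eq_of_nx hn hP hQ (fun u => (h1 u).1) (fun u => (h2 u).1) (tr h1 h2 h0)
  · right
    refine eq_of_nx hn hP (swP_le hn hQ) (fun u => (h1 u).1) (fun u => (cls_swP h2 u).1)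
      (tr h1 (cls_swP h2) ?_)
    rw [swP_nx h2]
    tauto

lemma swP_ne {P : SimpleGraph (PV n)} (h : Cls P) : P ≠ swP P := by
  intro he
  have := swP_nx h (0, false)
  rw [← he] at this
  tauto

lemma cls_of_meander (hn : 3 ≤ n) {v : PV n} (H : (prismG n).Walk v v) (hH : H.IsHamiltonianCycle)
    (hM : Meandering H) : Cls H.toSubgraph.spanningCoe := by
  have : NeZero n := ⟨by omega⟩
  obtain ⟨h1, h2, h3⟩ := ham_of_cycle H hH
  have hp : ∀ u, H.toSubgraph.spanningCoe.Adj u (pil u) := by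
    intro u
    have d := (nbr_iff hn h1 u).1 (h2.1 u)
    have hnot : ¬ (H.toSubgraph.spanningCoe.Adj u (nx u) ∧ H.toSubgraph.spanningCoe.Adj u (pv u)) := by
      rintro ⟨a, b⟩
      have a' : s(u, nx u) ∈ H.edges := by
        have : s(u, nx u) ∈ {e | e ∈ H.edges} := by rw [← h3]; exact a
        exact this
      have b' : s(u, pv u) ∈ H.edges := by
        have : s(u, pv u) ∈ {e | e ∈ H.edges} := by rw [← h3]; exact b
        exact this
      refine hM _ a' _ b' ?_ ?_ ⟨u, by simp, by simp⟩
      · intro h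
        rw [Sym2.congr_right] at h
        exact nx_ne_pv hn u h
      · obtain ⟨i, c⟩ := u
        cases c
        · left
          refine ⟨⟨i, rfl⟩, ⟨i - 1, ?_⟩⟩
          rw [Sym2.eq_swap]; simp [baseEdge, pv]
        · right
          refine ⟨⟨i, rfl⟩, ⟨i - 1, ?_⟩⟩
          rw [Sym2.eq_swap]; simp [topEdge, pv]
    unfold Ex2 at d
    tauto
  apply cls_of_ham hn h1 h2
  have : {i : ZMod n | H.toSubgraph.spanningCoe.Adj (i, false) (i, true)} = Set.univ := by
    ext i; simp only [Set.mem_ofPred_eq, Set.mem_univ, iff_true]; exact hp (i, false)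
  rw [this, Set.ncard_univ, Nat.card_zmod]
  exact hn
end

section
variable {n : ℕ} (S : Finset (PV n)) (o : PV n → Bool)

def KK (P : SimpleGraph (PV n)) (X : PV n → SimpleGraph (Fin 15)) : SimpleGraph (InflV n S) where
  Adj x y := (x.1.1 = y.1.1 ∧ x.1.1 ∈ S ∧ (X x.1.1).Adj x.1.2 y.1.2) ∨
    (P.Adj x.1.1 y.1.1 ∧ x.1.2 = port S o x.1.1 y.1.1 ∧ y.1.2 = port S o y.1.1 x.1.1)
  symm := ⟨by
    rintro x y (⟨h1, h2, h3⟩ | ⟨h1, h2, h3⟩)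
    · exact Or.inl ⟨h1.symm, h1 ▸ h2, h1 ▸ h3.symm⟩
    · exact Or.inr ⟨h1.symm, h3, h2⟩⟩
  loopless := ⟨by
    rintro x (⟨-, -, h⟩ | ⟨h, -, -⟩)
    · exact (X x.1.1).loopless.irrefl _ h
    · exact P.loopless.irrefl _ h⟩

lemma KK_adj (P : SimpleGraph (PV n)) (X : PV n → SimpleGraph (Fin 15)) (x y : InflV n S) :
    (KK S o P X).Adj x y ↔ (x.1.1 = y.1.1 ∧ x.1.1 ∈ S ∧ (X x.1.1).Adj x.1.2 y.1.2) ∨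
    (P.Adj x.1.1 y.1.1 ∧ x.1.2 = port S o x.1.1 y.1.1 ∧ y.1.2 = port S o y.1.1 x.1.1) := Iff.rfl

lemma infl_eq : inflPrism n S o = KK S o (prismG n) (fun _ => TF) := by
  have key : ∀ x y : InflV n S, ((x.val.1 = y.val.1 ∧ x.val.1 ∈ S ∧ TF.Adj x.val.2 y.val.2) ∨
    (x.val.1 ≠ y.val.1 ∧ (prismG n).Adj x.val.1 y.val.1 ∧
      x.val.2 = port S o x.val.1 y.val.1 ∧
      y.val.2 = port S o y.val.1 x.val.1)) ↔ (KK S o (prismG n) (fun _ => TF)).Adj x y := by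
    intro x y
    rw [KK_adj]
    constructor
    · rintro (h | ⟨-, h⟩)
      exacts [Or.inl h, Or.inr h]
    · rintro (h | h)
      exacts [Or.inl h, Or.inr ⟨h.1.ne, h⟩]
  ext x y
  rw [inflPrism, fromRel_adj, key, key, adj_comm _ y x, or_self, and_iff_right_iff_imp]
  exact fun h => h.ne

def PPg (K : SimpleGraph (InflV n S)) : SimpleGraph (PV n) where
  Adj u w := u ≠ w ∧ K.Adj (liftV S o u w) (liftV S o w u)
  symm := ⟨fun _ _ h => ⟨h.1.symm, h.2.symm⟩⟩
  loopless := ⟨fun _ h => h.1 rfl⟩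

def XXg (K : SimpleGraph (InflV n S)) (u : PV n) : SimpleGraph (Fin 15) where
  Adj k l := ∃ h : u ∈ S, K.Adj ⟨(u, k), Or.inl h⟩ ⟨(u, l), Or.inl h⟩
  symm := ⟨fun _ _ ⟨h, h'⟩ => ⟨h, h'.symm⟩⟩
  loopless := ⟨fun _ ⟨_, h⟩ => K.loopless.irrefl _ h⟩

def mkV {n : ℕ} {S : Finset (PV n)} (u : PV n) (k : Fin 15) (h : u ∈ S ∨ k = 0) : InflV n S :=
  ⟨(u, k), h⟩

variable {S o}

lemma mkV_inj {u w : PV n} {k l : Fin 15} {h : u ∈ S ∨ k = 0} {h' : w ∈ S ∨ l = 0}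
    (e : mkV u k h = mkV w l h') : u = w ∧ k = l := by
  have e := congrArg Subtype.val e
  simpa [mkV] using e

lemma port_mem (u w : PV n) : u ∈ S ∨ port S o u w = 0 := (liftV S o u w).2

lemma liftV_eq (u w : PV n) : liftV S o u w = mkV u (port S o u w) (port_mem u w) := rfl

lemma KK_adj' (P : SimpleGraph (PV n)) (X : PV n → SimpleGraph (Fin 15)) {u w : PV n} {k l : Fin 15}
    {h : u ∈ S ∨ k = 0} {h' : w ∈ S ∨ l = 0} :
    (KK S o P X).Adj (mkV u k h) (mkV w l h') ↔ (u = w ∧ u ∈ S ∧ (X u).Adj k l) ∨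
    (P.Adj u w ∧ k = port S o u w ∧ l = port S o w u) := Iff.rfl

lemma mkV_surj (x : InflV n S) : ∃ u k h, x = mkV u k h := ⟨x.1.1, x.1.2, x.2, rfl⟩

lemma KK_mono {P Q : SimpleGraph (PV n)} {X Y : PV n → SimpleGraph (Fin 15)} (hP : P ≤ Q)
    (hX : ∀ u ∈ S, X u ≤ Y u) : KK S o P X ≤ KK S o Q Y := by
  rintro x y (⟨h1, h2, h3⟩ | ⟨h1, h2, h3⟩)
  · exact Or.inl ⟨h1, h2, hX _ h2 h3⟩
  · exact Or.inr ⟨hP h1, h2, h3⟩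

lemma PPg_KK (P : SimpleGraph (PV n)) (X : PV n → SimpleGraph (Fin 15)) :
    PPg S o (KK S o P X) = P := by
  ext u w
  constructor
  · rintro ⟨hne, (⟨h1, -⟩ | ⟨h1, -⟩)⟩
    · exact absurd h1 hne
    · exact h1
  · intro h
    exact ⟨h.ne, Or.inr ⟨h, rfl, rfl⟩⟩

lemma XXg_KK (P : SimpleGraph (PV n)) (X : PV n → SimpleGraph (Fin 15)) {u : PV n} (hu : u ∈ S) :
    XXg S (KK S o P X) u = X u := by
  ext k l
  constructor
  · rintro ⟨h, (⟨-, -, h1⟩ | ⟨h1, -⟩)⟩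
    · exact h1
    · exact absurd rfl h1.ne
  · intro h
    exact ⟨hu, Or.inl ⟨rfl, hu, h⟩⟩

lemma XXg_bot (K : SimpleGraph (InflV n S)) {u : PV n} (hu : u ∉ S) : XXg S K u = ⊥ := by
  ext k l
  simp [XXg, hu]

lemma PPg_le {K : SimpleGraph (InflV n S)} (hK : K ≤ inflPrism n S o) : PPg S o K ≤ prismG n := by
  intro u w h
  have h1 := hK h.2
  rw [infl_eq] at h1
  rcases h1 with ⟨h1, -⟩ | ⟨h1, -⟩
  · exact absurd h1 h.1
  · exact h1

lemma XXg_le {K : SimpleGraph (InflV n S)} (hK : K ≤ inflPrism n S o) (u : PV n) :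
    XXg S K u ≤ TF := by
  rintro k l ⟨hu, h⟩
  have h1 := hK h
  rw [infl_eq] at h1
  rcases h1 with ⟨-, -, h1⟩ | ⟨h1, -⟩
  · exact h1
  · exact absurd rfl h1.ne

lemma KK_recon {K : SimpleGraph (InflV n S)} (hK : K ≤ inflPrism n S o) :
    KK S o (PPg S o K) (XXg S K) = K := by
  ext x y
  rw [KK_adj]
  constructor
  · rintro (⟨h1, h2, ⟨h3, h4⟩⟩ | ⟨⟨h1, h2⟩, h3, h4⟩)
    · obtain ⟨⟨u, k⟩, hx⟩ := x
      obtain ⟨⟨w, l⟩, hy⟩ := y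
      simp only at h1
      subst h1
      exact h4
    · obtain ⟨⟨u, k⟩, hx⟩ := x
      obtain ⟨⟨w, l⟩, hy⟩ := y
      simp only at h3 h4 h2
      subst h3 h4
      exact h2
  · intro h
    have h1 := hK h
    rw [infl_eq] at h1
    obtain ⟨⟨u, k⟩, hx⟩ := x
    obtain ⟨⟨w, l⟩, hy⟩ := y
    rcases h1 with ⟨h1, h2, h3⟩ | ⟨h1, h2, h3⟩
    · simp only at h1
      subst h1
      exact Or.inl ⟨rfl, h2, h2, h⟩
    · simp only at h1 h2 h3
      subst h2 h3
      exact Or.inr ⟨⟨h1.ne, h⟩, rfl, rfl⟩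

variable (S o) in
/-- active ports -/
def Act (P : SimpleGraph (PV n)) (u : PV n) (k : Fin 15) : Prop := ∃ w, P.Adj u w ∧ port S o u w = k

lemma port_pil {u : PV n} (hu : u ∈ S) : port S o u (pil u) = 2 := by
  simp [port, hu, pil]

lemma port_nx (hn : 3 ≤ n) {u : PV n} (hu : u ∈ S) :
    port S o u (nx u) = if o u then 0 else 1 := by
  simp [port, hu, nx, one_ne hn]

lemma port_pv (hn : 3 ≤ n) {u : PV n} (hu : u ∈ S) :
    port S o u (pv u) = if o u then 1 else 0 := by
  have h1 : ¬ (u.1 = u.1 - 1) := by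
    intro h; apply one_ne hn; linear_combination h
  have h2 : ¬ (u.1 - 1 = u.1 + 1) := by
    intro h; apply two_ne hn; linear_combination -h
  simp [port, hu, pv, h1, h2]

lemma port_inj (hn : 3 ≤ n) {u : PV n} (hu : u ∈ S) {w w' : PV n} (h : (prismG n).Adj u w)
    (h' : (prismG n).Adj u w') (e : port S o u w = port S o u w') : w = w' := by
  rcases (prism_adj hn _ _).1 h with rfl | rfl | rfl <;>
  rcases (prism_adj hn _ _).1 h' with rfl | rfl | rfl <;>
  first
  | rfl
  | (exfalso; cases ho : o u <;> simp [port_pil hu, port_nx hn hu, port_pv hn hu, ho] at e)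

lemma Act_lt (hn : 3 ≤ n) {u : PV n} (hu : u ∈ S) {P : SimpleGraph (PV n)} (hP : P ≤ prismG n)
    (k : Fin 15) (h : Act S o P u k) : k = 0 ∨ k = 1 ∨ k = 2 := by
  obtain ⟨w, hw, rfl⟩ := h
  rcases (prism_adj hn _ _).1 (hP hw) with rfl | rfl | rfl <;>
  simp only [port_pil hu, port_nx hn hu, port_pv hn hu] <;> cases o u <;> simp

lemma Act_2 (hn : 3 ≤ n) {u : PV n} (hu : u ∈ S) {P : SimpleGraph (PV n)} (hP : P ≤ prismG n) :
    Act S o P u 2 ↔ P.Adj u (pil u) := by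
  constructor
  · rintro ⟨w, hw, e⟩
    rcases (prism_adj hn _ _).1 (hP hw) with rfl | rfl | rfl
    · exact hw
    · rw [port_nx hn hu] at e; cases ho : o u <;> simp [ho] at e
    · rw [port_pv hn hu] at e; cases ho : o u <;> simp [ho] at e
  · exact fun h => ⟨_, h, port_pil hu⟩

lemma Act_nx (hn : 3 ≤ n) {u : PV n} (hu : u ∈ S) {P : SimpleGraph (PV n)} (hP : P ≤ prismG n) :
    Act S o P u (if o u then 0 else 1) ↔ P.Adj u (nx u) := by
  constructor
  · rintro ⟨w, hw, e⟩
    rcases (prism_adj hn _ _).1 (hP hw) with rfl | rfl | rfl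
    · rw [port_pil hu] at e; cases ho : o u <;> simp [ho] at e
    · exact hw
    · rw [port_pv hn hu] at e; cases ho : o u <;> simp [ho] at e
  · exact fun h => ⟨_, h, port_nx hn hu⟩

lemma Act_pv (hn : 3 ≤ n) {u : PV n} (hu : u ∈ S) {P : SimpleGraph (PV n)} (hP : P ≤ prismG n) :
    Act S o P u (if o u then 1 else 0) ↔ P.Adj u (pv u) := by
  constructor
  · rintro ⟨w, hw, e⟩
    rcases (prism_adj hn _ _).1 (hP hw) with rfl | rfl | rfl
    · rw [port_pil hu] at e; cases ho : o u <;> simp [ho] at e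
    · rw [port_nx hn hu] at e; cases ho : o u <;> simp [ho] at e
    · exact hw
  · exact fun h => ⟨_, h, port_pv hn hu⟩

open Classical in
lemma deg_in [NeZero n] (hn : 3 ≤ n) {P : SimpleGraph (PV n)} (hP : P ≤ prismG n)
    (X : PV n → SimpleGraph (Fin 15)) {u : PV n} (hu : u ∈ S) (k : Fin 15) :
    ((KK S o P X).neighborSet (mkV u k (Or.inl hu))).ncard =
      ((X u).neighborSet k).ncard + (if Act S o P u k then 1 else 0) := by
  have : Finite (InflV n S) := by unfold InflV; infer_instance
  have h1 : (KK S o P X).neighborSet (mkV u k (Or.inl hu)) =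
      (fun l => (mkV u l (Or.inl hu) : InflV n S)) '' ((X u).neighborSet k) ∪
      (fun w => liftV S o w u) '' {w | P.Adj u w ∧ port S o u w = k} := by
    ext y
    obtain ⟨w, l, hy, rfl⟩ := mkV_surj y
    simp only [mem_neighborSet, KK_adj', liftV_eq, Set.mem_union, Set.mem_image, Set.mem_ofPred_eq]
    constructor
    · rintro (⟨rfl, -, h⟩ | ⟨h, rfl, rfl⟩)
      · exact Or.inl ⟨l, h, rfl⟩
      · exact Or.inr ⟨w, ⟨h, rfl⟩, rfl⟩
    · rintro (⟨l', h, e⟩ | ⟨w', ⟨h, rfl⟩, e⟩)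
      · obtain ⟨rfl, rfl⟩ := mkV_inj e
        exact Or.inl ⟨rfl, hu, h⟩
      · obtain ⟨rfl, rfl⟩ := mkV_inj e
        exact Or.inr ⟨h, rfl, rfl⟩
  rw [h1, Set.ncard_union_eq]
  · congr 1
    · apply Set.ncard_image_of_injective
      intro a b h
      exact (mkV_inj h).2
    · rw [Set.ncard_image_of_injective]
      · split_ifs with hA
        · obtain ⟨w, hw, e⟩ := hA
          rw [Set.ncard_eq_one]
          refine ⟨w, ?_⟩
          ext w'
          simp only [Set.mem_ofPred_eq, Set.mem_singleton_iff]
          constructor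
          · rintro ⟨h, e'⟩
            exact port_inj hn hu (hP h) (hP hw) (e'.trans e.symm)
          · rintro rfl; exact ⟨hw, e⟩
        · have : {w | P.Adj u w ∧ port S o u w = k} = ∅ := by
            ext w
            simp only [Set.mem_ofPred_eq, Set.mem_empty_iff_false, iff_false]
            exact fun h => hA ⟨w, h⟩
          rw [this, Set.ncard_empty]
      · intro a b h
        exact (mkV_inj h).1
  · rw [Set.disjoint_left]
    rintro _ ⟨l, -, rfl⟩ ⟨w, ⟨hw, -⟩, e⟩
    exact hw.ne (mkV_inj e).1.symm

lemma deg_out {P : SimpleGraph (PV n)}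
    (X : PV n → SimpleGraph (Fin 15)) {u : PV n} (hu : u ∉ S) :
    ((KK S o P X).neighborSet (mkV u 0 (Or.inr rfl))).ncard = (P.neighborSet u).ncard := by
  have h1 : (KK S o P X).neighborSet (mkV u 0 (Or.inr rfl)) =
      (fun w => liftV S o w u) '' (P.neighborSet u) := by
    ext y
    obtain ⟨w, l, hy, rfl⟩ := mkV_surj y
    simp only [mem_neighborSet, KK_adj', liftV_eq, Set.mem_image, hu, false_and, and_false, false_or]
    constructor
    · rintro ⟨h, -, rfl⟩
      exact ⟨w, h, rfl⟩
    · rintro ⟨w', h, e⟩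
      obtain ⟨rfl, rfl⟩ := mkV_inj e
      exact ⟨h, by simp [port, hu], rfl⟩
  rw [h1, Set.ncard_image_of_injective]
  intro a b h
  exact (mkV_inj h).1

open Classical in
variable (S o) in
noncomputable def sd (P : SimpleGraph (PV n)) (u : PV n) : Bool := decide (Act S o P u 0)

lemma fwd (hn : 3 ≤ n) (hpil : 3 ≤ (inflatedPillars S).ncard) {P : SimpleGraph (PV n)}
    (hP : P ≤ prismG n) {X : PV n → SimpleGraph (Fin 15)} (hX : ∀ u ∈ S, X u ≤ TF)
    (h : Ham (KK S o P X)) : Cls P ∧ ∀ u ∈ S, X u ∈ LF (sd S o P u) := by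
  classical
  have : NeZero n := ⟨by omega⟩
  have hSne : (inflatedPillars S).Nonempty := Set.nonempty_of_ncard_ne_zero (by omega)
  have hother : ∀ u ∈ S, ∃ y : InflV n S, y.1.1 ≠ u := by
    intro u hu
    refine ⟨liftV S o (pil u) u, ?_⟩
    intro h
    have := congrArg Prod.snd h
    simp [liftV, pil] at this
  have hloc : ∀ u ∈ S, (Act S o P u 2 ∧ Act S o P u 0 ∧ ¬ Act S o P u 1 ∧ X u ∈ LF true) ∨
      (Act S o P u 2 ∧ ¬ Act S o P u 0 ∧ Act S o P u 1 ∧ X u ∈ LF false) := by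
    intro u hu
    apply loc (X u) (hX u hu) (Act S o P u) (Act_lt hn hu hP)
    · intro k
      rw [← deg_in hn hP X hu k]
      exact h.1 _
    · rintro W ⟨k, hk⟩ hA hW
      obtain ⟨y, hy⟩ := hother u hu
      have := h.cut {x | x.1.1 = u ∧ x.1.2 ∈ W} ⟨(u, k), Or.inl hu⟩ ⟨rfl, hk⟩ ?_ y
      · exact hy this.1
      · rintro ⟨⟨u', k'⟩, hx⟩ ⟨e, hk'⟩ ⟨⟨w, l⟩, hy⟩ hadj
        simp only at e hk'
        subst e
        rcases hadj with ⟨h1, h2, h3⟩ | ⟨h1, h2, h3⟩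
        · exact ⟨h1.symm, hW _ hk' _ h3⟩
        · exact absurd ⟨w, h1, h2.symm⟩ (hA _ hk')
  have hHam : Ham P := by
    constructor
    · intro u
      by_cases hu : u ∈ S
      · rw [nbr_iff hn hP]
        have a2 := Act_2 (o := o) hn hu hP
        have an := Act_nx (o := o) hn hu hP
        have ap := Act_pv (o := o) hn hu hP
        have hl := hloc u hu
        unfold Ex2
        cases ho : o u <;> simp only [ho, if_true, if_false, Bool.false_eq_true] at an ap <;> tauto
      · rw [← deg_out (o := o) X hu]
        exact h.1 _
    · have hne : Nonempty (PV n) := ⟨(0, false)⟩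
      refine ⟨fun a b => ?_⟩
      let z : PV n → InflV n S := fun u => liftV S o u u
      have hr : (z b).1.1 ∈ {w | P.Reachable a w} := by
        refine h.cut {x | P.Reachable a x.1.1} (z a) (Reachable.refl _) ?_ (z b)
        rintro x hx y (⟨h1, -⟩ | ⟨h1, -⟩)
        · change P.Reachable a y.1.1
          rw [← h1]; exact hx
        · exact Reachable.trans hx h1.reachable
      exact hr
  have hC : Cls P := by
    apply cls_of_ham hn hP hHam
    refine hpil.trans (Set.ncard_le_ncard ?_)
    intro i hi
    have hp : ∀ u ∈ S, P.Adj u (pil u) := by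
      intro u hu
      rw [← Act_2 (o := o) hn hu hP]
      rcases hloc u hu with h | h <;> exact h.1
    rcases hi with hi | hi
    · exact hp _ hi
    · exact (hp _ hi).symm
  refine ⟨hC, fun u hu => ?_⟩
  rcases hloc u hu with ⟨-, h0, -, hL⟩ | ⟨-, h0, -, hL⟩ <;> simpa [sd, h0] using hL

lemma act01 (hn : 3 ≤ n) {P : SimpleGraph (PV n)} (hP : P ≤ prismG n) (hC : Cls P) {u : PV n}
    (hu : u ∈ S) : Act S o P u 1 ↔ ¬ Act S o P u 0 := by
  have an := Act_nx (o := o) hn hu hP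
  have ap := Act_pv (o := o) hn hu hP
  have := (hC u).2.1
  cases ho : o u <;> simp only [ho, if_true, if_false, Bool.false_eq_true] at an ap <;> tauto

lemma bwd (hn : 3 ≤ n) {P : SimpleGraph (PV n)} (hP : P ≤ prismG n) (hH : Ham P) (hC : Cls P)
    {X : PV n → SimpleGraph (Fin 15)} (hX : ∀ u ∈ S, X u ∈ LF (sd S o P u)) :
    Ham (KK S o P X) := by
  classical
  have : NeZero n := ⟨by omega⟩
  constructor
  · rintro ⟨⟨u, k⟩, hx⟩
    by_cases hu : u ∈ S
    · refine (deg_in hn hP X hu k).trans ?_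
      rw [← LF_deg (hX u hu) k]
      congr 1
      have h01 := act01 (o := o) hn hP hC hu
      have h2 : Act S o P u 2 := (Act_2 hn hu hP).2 (hC u).1
      have hiff : Act S o P u k ↔ (k = 2 ∨ k = if sd S o P u = true then 0 else 1) := by
        constructor
        · intro hk
          rcases Act_lt hn hu hP k hk with rfl | rfl | rfl
          · right; simp [sd, hk]
          · right
            have := h01.1 hk
            simp [sd, this]
          · left; rfl
        · rintro (rfl | rfl)
          · exact h2
          · by_cases h0 : Act S o P u 0
            · simpa [sd, h0] using h0
            · simpa [sd, h0] using h01.2 h0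
      simp only [hiff]
    · have hk : k = 0 := hx.resolve_left hu
      subst hk
      exact (deg_out X hu).trans (hH.1 u)
  · have hne : Nonempty (InflV n S) := ⟨liftV S o (0, false) (0, false)⟩
    have hfib : ∀ x y : InflV n S, x.1.1 = y.1.1 → (KK S o P X).Reachable x y := by
      rintro ⟨⟨u, k⟩, hx⟩ ⟨⟨u', l⟩, hy⟩ e
      simp only at e
      subst e
      by_cases hu : u ∈ S
      · let f : X u →g KK S o P X := ⟨fun k => ⟨(u, k), Or.inl hu⟩, fun h => Or.inl ⟨rfl, hu, h⟩⟩
        exact ((LF_conn (hX u hu)).preconnected k l).map f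
      · have hk : k = 0 := hx.resolve_left hu
        have hl : l = 0 := hy.resolve_left hu
        subst hk hl
        exact Reachable.refl _
    have hw : ∀ u w : PV n, P.Reachable u w → ∀ x y : InflV n S, x.1.1 = u → y.1.1 = w →
        (KK S o P X).Reachable x y := by
      rintro u w ⟨p⟩
      induction p with
      | nil => intro x y hx hy; exact hfib x y (hx.trans hy.symm)
      | @cons a b c hab p ih =>
        intro x y hx hy
        have h1 := hfib x (liftV S o a b) hx
        have h2 : (KK S o P X).Adj (liftV S o a b) (liftV S o b a) := Or.inr ⟨hab, rfl, rfl⟩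
        exact (h1.trans h2.reachable).trans (ih _ y rfl hy)
    exact ⟨fun x y => hw _ _ (hH.2.preconnected x.1.1 y.1.1) x y rfl rfl⟩

open Classical in
variable (S o) in
noncomputable def famF [NeZero n] (P : SimpleGraph (PV n)) :
    Finset (PV n → SimpleGraph (Fin 15)) :=
  Fintype.piFinset fun u => if u ∈ S then LF (sd S o P u) else {⊥}

lemma fam_card [NeZero n] (P : SimpleGraph (PV n)) :
    ((fun X => KK S o P X) '' (famF S o P : Set (PV n → SimpleGraph (Fin 15)))).ncard =
      2 ^ (S.filter fun u => sd S o P u = true).card *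
      4 ^ (S.filter fun u => ¬ sd S o P u = true).card := by
  classical
  rw [Set.InjOn.ncard_image, Set.ncard_coe_finset, famF, Fintype.card_piFinset]
  · have : ∀ u, (if u ∈ S then LF (sd S o P u) else {⊥}).card =
        if u ∈ S then (if sd S o P u = true then 2 else 4) else 1 := by
      intro u
      by_cases h1 : u ∈ S <;> simp [LF_card, h1]
    rw [Finset.prod_congr rfl (fun u _ => this u), Finset.prod_ite_mem, Finset.univ_inter,
      Finset.prod_ite, Finset.prod_const, Finset.prod_const]
  · intro X hX Y hY h
    funext u
    by_cases hu : u ∈ S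
    · have h := congrArg (fun K => XXg S K u) h
      simpa only [XXg_KK _ _ hu] using h
    · have a := Fintype.mem_piFinset.1 hX u
      have b := Fintype.mem_piFinset.1 hY u
      simp only [hu, if_false, Finset.mem_singleton] at a b
      rw [a, b]

lemma ham_sets [NeZero n] (hn : 3 ≤ n) (hpil : 3 ≤ (inflatedPillars S).ncard)
    {P : SimpleGraph (PV n)}
    (hP : P ≤ prismG n) (hH : Ham P) (hC : Cls P) :
    {K | K ≤ inflPrism n S o ∧ Ham K} =
      ((fun X => KK S o P X) '' (famF S o P : Set (PV n → SimpleGraph (Fin 15)))) ∪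
      ((fun X => KK S o (swP P) X) '' (famF S o (swP P) : Set (PV n → SimpleGraph (Fin 15)))) := by
  classical
  have hmem : ∀ Q (X : PV n → SimpleGraph (Fin 15)), X ∈ famF S o Q →
      ∀ u ∈ S, X u ∈ LF (sd S o Q u) := by
    intro Q X hX u hu
    have := Fintype.mem_piFinset.1 hX u
    simpa [hu] using this
  have hb : ∀ Q (X : PV n → SimpleGraph (Fin 15)), X ∈ famF S o Q → Q ≤ prismG n → Ham Q →
      Cls Q → KK S o Q X ∈ {K | K ≤ inflPrism n S o ∧ Ham K} := by
    intro Q X hX h1 h2 h3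
    refine ⟨?_, bwd hn h1 h2 h3 (hmem Q X hX)⟩
    rw [infl_eq]
    exact KK_mono h1 (fun u hu => LF_le (hmem Q X hX u hu))
  ext K
  constructor
  · rintro ⟨h1, h2⟩
    have hr := KK_recon h1
    rw [← hr] at h2
    obtain ⟨c, hx⟩ := fwd hn hpil (PPg_le h1) (fun u _ => XXg_le h1 u) h2
    have hfam : XXg S K ∈ famF S o (PPg S o K) := by
      apply Fintype.mem_piFinset.2
      intro u
      by_cases hu : u ∈ S
      · simpa [hu] using hx u hu
      · simpa [hu] using XXg_bot K hu
    rcases cls_two hn (PPg_le h1) hP c hC with e | e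
    · left
      exact ⟨XXg S K, by rw [← e]; exact hfam, by simp only; rw [← e]; exact hr⟩
    · right
      exact ⟨XXg S K, by rw [← e]; exact hfam, by simp only; rw [← e]; exact hr⟩
  · rintro (⟨X, hX, rfl⟩ | ⟨X, hX, rfl⟩)
    · exact hb _ _ hX hP hH hC
    · exact hb _ _ hX (swP_le hn hP) (swP_ham hH) (cls_swP hC)

lemma sd_sw (hn : 3 ≤ n) {P : SimpleGraph (PV n)} (hP : P ≤ prismG n) (hC : Cls P) {u : PV n}
    (hu : u ∈ S) : sd S o (swP P) u = true ↔ ¬ sd S o P u = true := by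
  have an := Act_nx (o := o) hn hu hP
  have an' := Act_nx (o := o) hn hu (swP_le hn hP)
  have h1 := act01 (o := o) hn hP hC hu
  have h2 := act01 (o := o) hn (swP_le hn hP) (cls_swP hC) hu
  have := swP_nx hC u
  simp only [sd, decide_eq_true_eq]
  cases ho : o u <;> simp only [ho, if_true, if_false, Bool.false_eq_true] at an an' <;> tauto
end

/-- Let `G` be obtained from the even prism `C_n □ K_2` by `q = |S|`
TF-inflations (at vertices of at least `3` distinct pillars, the `c`-vertex incident to the
pillar).  If a fixed meandering hamiltonian cycle `H` of the prism enters `q₁` of the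
fragments through the `a`-vertex (and the other `q − q₁` through the `b`-vertex), then `G`
has exactly `2^{q₁}·4^{q−q₁} + 4^{q₁}·2^{q−q₁}` hamiltonian cycles (as edge sets). -/
theorem stmt15 (n : ℕ) (hn : 3 ≤ n) (heven : Even n) (S : Finset (PV n))
    (orient : PV n → Bool) (hpil : 3 ≤ (inflatedPillars S).ncard)
    {v : PV n} (H : (prismG n).Walk v v) (hH : H.IsHamiltonianCycle) (hM : Meandering H)
    (q₁ : ℕ)
    (hq₁ : q₁ = {u : PV n | u ∈ S ∧ ∃ w : PV n, w.2 = u.2 ∧ s(u, w) ∈ H.edges ∧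
        port S orient u w = 0}.ncard) :
    {E : Set (Sym2 (InflV n S)) |
        ∃ (x : InflV n S) (C : (inflPrism n S orient).Walk x x),
          C.IsHamiltonianCycle ∧ E = {e | e ∈ C.edges}}.ncard =
      2 ^ q₁ * 4 ^ (S.card - q₁) + 4 ^ q₁ * 2 ^ (S.card - q₁) := by
  have : NeZero n := ⟨by omega⟩
  have : Finite (InflV n S) := by unfold InflV; infer_instance
  obtain ⟨hP, hHam, hE⟩ := ham_of_cycle H hH
  have hC := cls_of_meander hn H hH hM
  have hadj : ∀ u w, s(u, w) ∈ H.edges ↔ H.toSubgraph.spanningCoe.Adj u w := by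
    intro u w
    rw [← mem_edgeSet, hE]
    rfl
  generalize H.toSubgraph.spanningCoe = P at hP hHam hC hadj
  have hq : q₁ = (S.filter fun u => sd S orient P u = true).card := by
    rw [hq₁, ← Set.ncard_coe_finset]
    congr 1
    ext u
    rw [Finset.mem_coe, Finset.mem_filter]
    simp only [Set.mem_ofPred_eq, hadj]
    rw [show sd S orient P u = true ↔ ∃ w, P.Adj u w ∧ port S orient u w = 0 from
      @decide_eq_true_iff _ (Classical.propDecidable _)]
    refine and_congr_right fun hu => exists_congr fun w => ?_
    constructor
    · exact fun h => h.2
    · rintro ⟨h1, h2⟩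
      refine ⟨?_, h1, h2⟩
      rcases (prism_adj hn _ _).1 (hP h1) with rfl | rfl | rfl
      · rw [port_pil hu] at h2
        exact absurd h2 (by decide)
      · rfl
      · rfl
  have hsum := Finset.card_filter_add_card_filter_not (s := S) (fun u => sd S orient P u = true)
  have hq' : (S.filter fun u => ¬ sd S orient P u = true).card = S.card - q₁ := by omega
  have e1 : (S.filter fun u => sd S orient (swP P) u = true) =
      S.filter fun u => ¬ sd S orient P u = true :=
    Finset.filter_congr fun u hu => sd_sw hn hP hC hu
  have e2 : (S.filter fun u => ¬ sd S orient (swP P) u = true) =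
      S.filter fun u => sd S orient P u = true :=
    Finset.filter_congr fun u hu => by rw [sd_sw hn hP hC hu, not_not]
  rw [ham_ncard, ham_sets hn hpil hP hHam hC, Set.ncard_union_eq, fam_card, fam_card, e1, e2, hq',
    ← hq]
  · ring
  · rw [Set.disjoint_left]
    rintro _ ⟨X, -, rfl⟩ ⟨Y, -, e⟩
    have e := congrArg (PPg S orient) e
    simp only [PPg_KK] at e
    exact swP_ne hC e.symm
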